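/- For any 3-form φ on ℝ⁶ (with K, F defined relative to a fixed volume form) and any vector X, the identity ι_X φ ∧ F(φ) = −φ ∧ ι_X F(φ) holds, and both equal ½ ι_X(φ ∧ F(φ)). -/

import Mathlib

noncomputable section

/-- The model 6-dimensional real vector space. -/
abbrev V6 := Fin 6 → ℝ

/-- Alternating k-forms on V6. -/
abbrev Form (k : ℕ) := AlternatingMap ℝ V6 ℝ (Fin k)

/-- Wedge product of alternating forms (determinant convention). -/
noncomputable def wedge {a b : ℕ} (φ : Form a) (ψ : Form b) : Form (a + b) :=
  AlternatingMap.domDomCongr finSumFinEquiv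
    ((TensorProduct.lid ℝ ℝ).toLinearMap.compAlternatingMap (AlternatingMap.domCoprod φ ψ))

infixl:70 " ⋏ " => wedge

/-- Interior product (contraction) of a form with a vector. -/
noncomputable def iota (v : V6) {k : ℕ} (φ : Form (k + 1)) : Form k :=
  AlternatingMap.curryLeft φ v

/-- The standard dual basis 1-forms e¹, …, e⁶ (0-indexed). -/
noncomputable def e (i : Fin 6) : Form 1 :=
  AlternatingMap.ofSubsingleton ℝ V6 ℝ 0 (LinearMap.proj i)

/-- The standard basis vectors e₁, …, e₆ (0-indexed). -/
def b (i : Fin 6) : V6 := Pi.single i 1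

/-- The standard volume form e¹∧e²∧e³∧e⁴∧e⁵∧e⁶. -/
noncomputable def vol : Form 6 := e 0 ⋏ e 1 ⋏ e 2 ⋏ e 3 ⋏ e 4 ⋏ e 5

open Equiv

/-- A sum over permutations of `Fin (n + 1)`, split according to the image of `0`. -/
theorem sum_perm_fin_succ {n : ℕ} {M : Type*} [AddCommMonoid M] (f : Perm (Fin (n + 1)) → M) :
    ∑ σ, f σ = ∑ p : Fin (n + 1), ∑ τ : Perm (Fin n),
      f (p.cycleRange⁻¹ * Perm.decomposeFin.symm (0, τ)) := by
  rw [← Fintype.sum_prod_type']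
  refine (Function.Bijective.sum_comp (g := f)
    (e := fun x : Fin (n + 1) × Perm (Fin n) =>
      x.1.cycleRange⁻¹ * Perm.decomposeFin.symm (0, x.2)) ?_).symm
  rw [Fintype.bijective_iff_injective_and_card]
  refine ⟨?_, Fintype.card_congr Perm.decomposeFin.symm⟩
  rintro ⟨p, τ⟩ ⟨q, ρ⟩ h
  have hpq : p = q := by simpa [Perm.inv_def] using Equiv.congr_fun h 0
  subst hpq
  simpa using h

theorem comp_cycleRange_inv_mul {n : ℕ} {α : Type*} (v : Fin (n + 1) → α) (p : Fin (n + 1))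
    (τ : Perm (Fin n)) :
    v ∘ ⇑(p.cycleRange⁻¹ * Perm.decomposeFin.symm (0, τ)) =
      Matrix.vecCons (v p) (p.removeNth v ∘ τ) := by
  funext i
  refine Fin.cases ?_ (fun i => ?_) i <;> simp [Perm.inv_def, Fin.removeNth]

theorem vecCons_comp_cycleRange_inv_mul_inv {n : ℕ} {α : Type*} (x : α) (v : Fin n → α)
    (p : Fin (n + 1)) (τ : Perm (Fin n)) :
    Matrix.vecCons x v ∘ ⇑(p.cycleRange⁻¹ * Perm.decomposeFin.symm (0, τ))⁻¹ =
      p.insertNth x (v ∘ ⇑τ⁻¹) := by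
  rw [Perm.inv_def, Equiv.comp_symm_eq]
  funext i
  refine Fin.cases ?_ (fun i => ?_) i <;> simp [Perm.inv_def]

theorem sign_cycleRange_inv_mul {n : ℕ} (p : Fin (n + 1)) (τ : Perm (Fin n)) :
    Perm.sign (p.cycleRange⁻¹ * Perm.decomposeFin.symm (0, τ)) = (-1) ^ (p : ℕ) * Perm.sign τ := by
  simp [Fin.sign_cycleRange]

/-- The wedge product as a normalized sum over all permutations. -/
theorem factorial_mul_wedge_apply {a b : ℕ} (φ : Form a) (ψ : Form b) (v : Fin (a + b) → V6) :
    ((a.factorial * b.factorial : ℕ) : ℝ) * (φ ⋏ ψ) v =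
      ∑ σ : Perm (Fin (a + b)), ((Perm.sign σ : ℤ) : ℝ) *
        (φ (fun i => v (σ (Fin.castAdd b i))) * ψ (fun i => v (σ (Fin.natAdd a i)))) := by
  have h := congrArg (fun η => TensorProduct.lid ℝ ℝ (η (v ∘ finSumFinEquiv)))
    (MultilinearMap.domCoprod_alternization_eq φ ψ)
  simp only [MultilinearMap.alternatization_apply, Fintype.card_fin, map_sum,
    AlternatingMap.smul_apply, map_nsmul] at h
  rw [← nsmul_eq_mul]
  refine h.symm.trans (Fintype.sum_equiv finSumFinEquiv.permCongr _ _ fun σ => ?_)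
  rw [Units.smul_def, map_zsmul]
  simp [MultilinearMap.domCoprod_apply, Perm.sign_permCongr]

theorem smul_wedge {a b : ℕ} (c : ℝ) (φ : Form a) (ψ : Form b) : (c • φ) ⋏ ψ = c • (φ ⋏ ψ) := by
  ext v
  simp [wedge, ← AlternatingMap.domCoprod'_apply, ← TensorProduct.smul_tmul']

theorem wedge_smul {a b : ℕ} (c : ℝ) (φ : Form a) (ψ : Form b) : φ ⋏ (c • ψ) = c • (φ ⋏ ψ) := by
  ext v
  simp [wedge, ← AlternatingMap.domCoprod'_apply]

theorem map_update_eq_iota {k : ℕ} (φ : Form (k + 1)) (v : Fin (k + 1) → V6) (i : Fin (k + 1))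
    (x : V6) : φ (Function.update v i x) = (-1) ^ (i : ℕ) * iota x φ (i.removeNth v) := by
  rw [← Fin.insertNth_removeNth, AlternatingMap.map_insertNth]
  simp [iota]

/-- Alternating `ι_{v p} φ ∧ ψ` over the entries of `v` recovers a multiple of `φ ∧ ψ`. -/
theorem sum_iota_wedge {a b : ℕ} (φ : Form (a + 1)) (ψ : Form b) (v : Fin (a + b + 1) → V6) :
    ∑ p : Fin (a + b + 1), (-1 : ℝ) ^ (p : ℕ) * (iota (v p) φ ⋏ ψ) (p.removeNth v) =
      (a + 1) * (φ ⋏ ψ) (v ∘ Fin.cast (Nat.add_right_comm a 1 b)) := by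
  have hab : ((a.factorial * b.factorial : ℕ) : ℝ) ≠ 0 := by positivity
  refine mul_left_cancel₀ hab ?_
  have h := factorial_mul_wedge_apply φ ψ (v ∘ Fin.cast (Nat.add_right_comm a 1 b))
  rw [Nat.factorial_succ] at h
  trans ((((a + 1) * a.factorial) * b.factorial : ℕ) : ℝ) *
    (φ ⋏ ψ) (v ∘ Fin.cast (Nat.add_right_comm a 1 b))
  swap
  · push_cast; ring
  rw [h, ← Equiv.sum_comp (finCongr (Nat.add_right_comm a 1 b)).permCongr.symm,
    sum_perm_fin_succ, Finset.mul_sum]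
  refine Finset.sum_congr rfl fun p _ => ?_
  rw [mul_left_comm, factorial_mul_wedge_apply, Finset.mul_sum]
  refine Finset.sum_congr rfl fun τ _ => ?_
  have hv := congrFun (comp_cycleRange_inv_mul v p τ)
  simp only [Function.comp_apply] at hv
  have hsign := sign_cycleRange_inv_mul p τ
  generalize p.cycleRange⁻¹ * Perm.decomposeFin.symm (0, τ) = σ at hv hsign
  have hl : (fun i : Fin (a + 1) => v (σ (Fin.cast (Nat.add_right_comm a 1 b)
      (Fin.castAdd b i)))) =
      Matrix.vecCons (v p) (fun i => p.removeNth v (τ (Fin.castAdd b i))) := by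
    funext i
    rw [hv]
    refine Fin.cases ?_ (fun i => ?_) i <;> rfl
  have hr : (fun i : Fin b => v (σ (Fin.cast (Nat.add_right_comm a 1 b)
      (Fin.natAdd (a + 1) i)))) = fun i => p.removeNth v (τ (Fin.natAdd a i)) := by
    funext i
    have : Fin.cast (Nat.add_right_comm a 1 b) (Fin.natAdd (a + 1) i) =
        (Fin.natAdd a i).succ := by
      ext; simp; omega
    rw [hv, this]
    rfl
  simp [Equiv.permCongr_symm, Perm.sign_permCongr, hsign, hl, hr, iota, mul_assoc]

/-- Graded commutativity makes the wedge square of a 3-form vanish. -/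
theorem wedge_self_three (φ : Form 3) : φ ⋏ φ = 0 := by
  ext v
  have h := factorial_mul_wedge_apply φ φ v
  let ρ : Perm (Fin (3 + 3)) := finAddFlip
  have hρ : Perm.sign ρ = -1 := by decide
  have hl : ∀ i : Fin 3, ρ (Fin.castAdd 3 i) = Fin.natAdd 3 i := by decide
  have hr : ∀ i : Fin 3, ρ (Fin.natAdd 3 i) = Fin.castAdd 3 i := by decide
  have h' := h
  rw [← Equiv.sum_comp (Equiv.mulRight ρ)] at h'
  simp only [Equiv.coe_mulRight, Perm.sign_mul, hρ, Perm.mul_apply, hl, hr, mul_neg, mul_one,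
    Units.val_neg, Int.cast_neg, neg_mul, Finset.sum_neg_distrib] at h'
  rw [Finset.sum_congr rfl fun σ _ => congrArg _ (mul_comm _ _), ← h] at h'
  norm_num [Nat.factorial] at h'
  simp only [AlternatingMap.zero_apply]
  linarith

theorem insertNth_castAdd_three {α : Type*} (p : Fin 3) (x : α) (u : Fin 5 → α) :
    (fun i => (Fin.castAdd 3 p).insertNth (α := fun _ => α) x u (Fin.castAdd 3 i)) =
        p.insertNth x (fun i : Fin 2 => u (Fin.castAdd 3 i)) ∧
      (fun i => (Fin.castAdd 3 p).insertNth (α := fun _ => α) x u (Fin.natAdd 3 i)) =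
        fun i : Fin 3 => u (Fin.natAdd 2 i) := by
  constructor <;> funext i <;> fin_cases p <;> fin_cases i <;> rfl

theorem insertNth_natAdd_three {α : Type*} (p : Fin 3) (x : α) (u : Fin 5 → α) :
    (fun i => (Fin.natAdd 3 p).insertNth (α := fun _ => α) x u (Fin.castAdd 3 i)) =
        (fun i : Fin 3 => u (Fin.castAdd 2 i)) ∧
      (fun i => (Fin.natAdd 3 p).insertNth (α := fun _ => α) x u (Fin.natAdd 3 i)) =
        p.insertNth x fun i : Fin 2 => u (Fin.natAdd 3 i) := by
  constructor <;> funext i <;> fin_cases p <;> fin_cases i <;> rfl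

/-- The contraction by a vector is an antiderivation on products of 3-forms. -/
theorem iota_wedge_three (φ ψ : Form 3) (X : V6) :
    iota X (φ ⋏ ψ : Form 6) = (iota X φ ⋏ ψ : Form 5) - φ ⋏ iota X ψ := by
  ext v
  have h := factorial_mul_wedge_apply φ ψ (Matrix.vecCons X v)
  have h₁ := factorial_mul_wedge_apply (iota X φ) ψ v
  have h₂ := factorial_mul_wedge_apply φ (iota X ψ) v
  have key : ∀ (p : Fin 6) (τ : Perm (Fin 5)) (i : Fin 6), Matrix.vecCons X v
      ((p.cycleRange⁻¹ * Perm.decomposeFin.symm (0, τ))⁻¹ i) = p.insertNth (α := fun _ => V6) X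
        (v ∘ ⇑τ⁻¹) i :=
    fun p τ => congrFun (vecCons_comp_cycleRange_inv_mul_inv X v p τ)
  rw [← Equiv.sum_comp (Equiv.inv _), sum_perm_fin_succ, Fin.sum_univ_add (a := 3) (b := 3)] at h
  rw [← Equiv.sum_comp (Equiv.inv _)] at h₁ h₂
  simp only [Equiv.inv_apply, Perm.sign_inv, sign_cycleRange_inv_mul, key] at h h₁ h₂
  simp only [(insertNth_castAdd_three _ _ _).1, (insertNth_castAdd_three _ _ _).2,
    (insertNth_natAdd_three _ _ _).1, (insertNth_natAdd_three _ _ _).2,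
    AlternatingMap.map_insertNth] at h
  have hsign : ∀ n : ℕ, ((-1 : ℝ) ^ n) * (-1) ^ n = 1 := fun n => by
    rw [← mul_pow]; norm_num
  have hl : ∀ (n : ℕ) (s : ℤˣ) (c d : ℝ),
      ((((-1) ^ n * s : ℤˣ) : ℤ) : ℝ) * (((-1 : ℤ) ^ n • c) * d) = ((s : ℤ) : ℝ) * (c * d) := by
    intro n s c d
    push_cast [zsmul_eq_mul]
    linear_combination ((s : ℤ) : ℝ) * c * d * hsign n
  have hr : ∀ (n : ℕ) (s : ℤˣ) (c d : ℝ),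
      ((((-1) ^ (3 + n) * s : ℤˣ) : ℤ) : ℝ) * (c * ((-1 : ℤ) ^ n • d)) =
        -(((s : ℤ) : ℝ) * (c * d)) := by
    intro n s c d
    push_cast [zsmul_eq_mul, pow_add]
    linear_combination -((s : ℤ) : ℝ) * c * d * hsign n
  simp only [Fin.val_castAdd, Fin.val_natAdd, hl, hr, Finset.sum_neg_distrib, Finset.sum_const,
    Finset.card_univ, Fintype.card_fin, nsmul_eq_mul, Function.comp_apply] at h
  simp only [iota, AlternatingMap.curryLeft_apply_apply, AlternatingMap.sub_apply] at h₁ h₂ ⊢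
  rw [← h₁, ← h₂] at h
  norm_num [Nat.factorial] at h
  linarith

/-- The derivation of the exterior algebra induced by an endomorphism obeys the Leibniz rule. -/
theorem sum_wedge_update {a b : ℕ} (φ φ' : Form a) (ψ ψ' : Form b) (K : V6 →ₗ[ℝ] V6)
    (hφ : ∀ v, ∑ i, φ (Function.update v i (K (v i))) = φ' v)
    (hψ : ∀ v, ∑ i, ψ (Function.update v i (K (v i))) = ψ' v) (v : Fin (a + b) → V6) :
    ∑ i, (φ ⋏ ψ) (Function.update v i (K (v i))) = (φ' ⋏ ψ) v + (φ ⋏ ψ') v := by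
  have hab : ((a.factorial * b.factorial : ℕ) : ℝ) ≠ 0 := by positivity
  refine mul_left_cancel₀ hab ?_
  simp only [mul_add, Finset.mul_sum, factorial_mul_wedge_apply]
  rw [Finset.sum_comm, ← Finset.sum_add_distrib]
  refine Finset.sum_congr rfl fun σ _ => ?_
  rw [← Equiv.sum_comp σ, Fin.sum_univ_add, ← hφ, ← hψ, ← mul_add, Finset.sum_mul, Finset.mul_sum,
    mul_add, Finset.mul_sum, Finset.mul_sum]
  have hupd : ∀ j k y, Function.update v (σ j) y (σ k) = Function.update (v ∘ σ) j y k := by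
    intro j k y
    simp [Function.update_apply]
  have hne : ∀ (i : Fin a) (k : Fin b), Fin.castAdd b i ≠ Fin.natAdd a k := by
    intro i k h
    have := congrArg Fin.val h
    simp only [Fin.val_castAdd, Fin.val_natAdd] at this
    omega
  congr 1 <;> refine Finset.sum_congr rfl fun i _ => ?_ <;> congr 2 <;> congr 1 <;> funext k <;>
    simp [hupd, Function.update_apply, hne, (hne _ _).symm]

/-- The contraction identity, relative to an arbitrary 6-form in place of the volume form. -/
theorem iota_wedge_eq_of_iota_eq (φ F : Form 3) (η : Form 6) (K : V6 →ₗ[ℝ] V6)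
    (hK : ∀ v : V6, iota (K v) η = -(iota v φ ⋏ φ))
    (hF : ∀ v : V6, iota v F = (-2 : ℝ) • iota (K v) φ) :
    ∀ X : V6, iota X φ ⋏ F = -(φ ⋏ iota X F) ∧
      iota X φ ⋏ F = (1 / 2 : ℝ) • iota X (φ ⋏ F : Form 6) := by
  intro X
  have hφ : ∀ (v : Fin 3 → V6) (i : Fin 3),
      φ (Function.update v i (K (v i))) = -(1 / 2) * F v := by
    intro v i
    have h := map_update_eq_iota F v i (v i)
    rw [Function.update_eq_self, hF] at h
    rw [map_update_eq_iota, h, AlternatingMap.smul_apply, smul_eq_mul]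
    ring
  have hcons : ∀ {n : ℕ} (x : V6) (v : Fin n → V6) (i : Fin n) (y : V6),
      Function.update (Matrix.vecCons x v) i.succ y =
        Matrix.vecCons x (Function.update v i y) :=
    fun x v i y => (Fin.cons_update (α := fun _ => V6) x v i y).symm
  have hη : ∀ v : Fin 6 → V6, ∑ i, η (Function.update v i (K (v i))) = 0 := by
    intro v
    refine Eq.trans ?_ (neg_eq_zero.mpr ((sum_iota_wedge φ φ v).trans
      (mul_eq_zero_of_right _ (by rw [wedge_self_three, AlternatingMap.zero_apply]))))
    rw [← Finset.sum_neg_distrib]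
    refine Finset.sum_congr rfl fun i _ => ?_
    rw [map_update_eq_iota, hK, AlternatingMap.neg_apply, mul_neg]
  have hcomm : iota X F ⋏ φ = φ ⋏ iota X F := by
    have h := iota_wedge_three φ φ (K X)
    rw [wedge_self_three] at h
    rw [hF, smul_wedge, wedge_smul]
    have h' : iota (K X) φ ⋏ φ = φ ⋏ iota (K X) φ := sub_eq_zero.mp h.symm
    exact congrArg (fun η => (-2 : ℝ) • η) h'
  have hfirst : iota X φ ⋏ F = -(φ ⋏ iota X F) := by
    rw [← hcomm]
    ext w
    have hD := sum_wedge_update (iota X φ) ((-1 : ℝ) • iota X F) φ ((-3 / 2 : ℝ) • F) K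
      (fun v => by
        have h := fun i : Fin 2 => hφ (Matrix.vecCons X v) i.succ
        simp only [hcons, Matrix.cons_val_succ] at h
        simp only [iota, AlternatingMap.curryLeft_apply_apply, AlternatingMap.smul_apply, h,
          Finset.sum_const, Finset.card_univ, Fintype.card_fin, nsmul_eq_mul, smul_eq_mul]
        push_cast
        ring)
      (fun v => by
        simp only [hφ, Finset.sum_const, Finset.card_univ, Fintype.card_fin,
          AlternatingMap.smul_apply, nsmul_eq_mul, smul_eq_mul]
        push_cast
        ring) w
    have hv := hη (Matrix.vecCons (K X) w)
    rw [Fin.sum_univ_succ] at hv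
    have hKw : ∀ Y u, η (Matrix.vecCons (K Y) u) = -(iota Y φ ⋏ φ : Form 5) u :=
      fun Y u => DFunLike.congr_fun (hK Y) u
    have hzero : Function.update (Matrix.vecCons (K X) w) 0 (K (K X)) =
      Matrix.vecCons (K (K X)) w := Fin.update_cons_zero (α := fun _ => V6) _ _ _
    simp only [Matrix.cons_val_zero, Matrix.cons_val_succ, hcons, hzero, hKw,
      Finset.sum_neg_distrib] at hv
    rw [smul_wedge, wedge_smul] at hD
    rw [hF, smul_wedge] at hD ⊢
    simp only [AlternatingMap.smul_apply, AlternatingMap.neg_apply, smul_eq_mul] at hD ⊢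
    linarith
  refine ⟨hfirst, ?_⟩
  rw [iota_wedge_three, hfirst]
  ext w
  simp only [AlternatingMap.smul_apply, AlternatingMap.sub_apply, AlternatingMap.neg_apply,
    smul_eq_mul]
  ring

/-- For any 3-form φ (with K, F defined relative to the fixed volume form) and any
vector X: ι_X φ ∧ F(φ) = −φ ∧ ι_X F(φ), and both equal ½ ι_X(φ ∧ F(φ)). -/
theorem contraction_identity_one (φ F : Form 3) (K : V6 →ₗ[ℝ] V6)
    (hK : ∀ v : V6, iota (K v) vol = -(iota v φ ⋏ φ))
    (hF : ∀ v : V6, iota v F = (-2 : ℝ) • iota (K v) φ) :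
    ∀ X : V6, iota X φ ⋏ F = -(φ ⋏ iota X F) ∧
      iota X φ ⋏ F = (1 / 2 : ℝ) • iota X (φ ⋏ F : Form 6) := by
  exact iota_wedge_eq_of_iota_eq φ F vol K hK hF
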